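/- For every n ≥ 0, c_{n+1}·∫₀^∞ B_{n+1}'(v)·B_n(v)·w(v) dv = n + 1, where B_{n+1}' denotes the derivative of the polynomial B_{n+1}. -/

import Mathlib

open MeasureTheory Polynomial

theorem aux_integrable (u T : ℝ) (hT : 0 < T)
    (w : ℝ → ℝ) (hw : ∀ v, w v = Real.exp (-(v - u) ^ 2 / (2 * T))) (P : ℝ[X]) :
    Integrable (fun v => P.eval v * w v) := by
  have hb : 0 < 1 / (2 * T) := by positivity
  have key : ∀ Q : ℝ[X],
      Integrable (fun v : ℝ => Q.eval v * Real.exp (-(1 / (2 * T)) * v ^ 2)) := by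
    intro Q
    induction Q using Polynomial.induction_on' with
    | add p q hp hq =>
      refine (hp.add hq).congr (Filter.Eventually.of_forall fun v => ?_)
      simp [add_mul]
    | monomial k a =>
      have h := integrable_rpow_mul_exp_neg_mul_sq hb (s := (k : ℝ))
        (by have : (0 : ℝ) ≤ k := Nat.cast_nonneg k
            linarith)
      refine (h.const_mul a).congr (Filter.Eventually.of_forall fun v => ?_)
      simp [Polynomial.eval_monomial, mul_assoc]
  have h := (key (P.comp (X + C u))).comp_sub_right u
  refine h.congr (Filter.Eventually.of_forall fun v => ?_)
  simp only [eval_comp, eval_add, eval_X, eval_C, sub_add_cancel, hw]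
  congr 2
  field_simp

theorem aux_orth (u T : ℝ) (hT : 0 < T)
    (w : ℝ → ℝ) (hw : ∀ v, w v = Real.exp (-(v - u) ^ 2 / (2 * T)))
    (B : ℕ → Polynomial ℝ)
    (hdeg : ∀ n, (B n).natDegree = n)
    (hlead : ∀ n, 0 < (B n).leadingCoeff)
    (horth : ∀ m n, ∫ v in Set.Ioi (0 : ℝ), (B m).eval v * (B n).eval v * w v
        = if m = n then 1 else 0) (n m : ℕ) (hm : m ≤ n) :
    ∀ R : ℝ[X], R.degree < m →
      ∫ v in Set.Ioi (0 : ℝ), R.eval v * (B n).eval v * w v = 0 := by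
  have hint : ∀ P Q : ℝ[X], IntegrableOn (fun v => P.eval v * Q.eval v * w v) (Set.Ioi 0) := by
    intro P Q
    have := (aux_integrable u T hT w hw (P * Q)).integrableOn (s := Set.Ioi 0)
    simpa only [eval_mul] using this
  induction m with
  | zero =>
    intro R hR
    have : R = 0 := by
      rw [← Polynomial.degree_eq_bot]
      simpa using hR
    simp [this]
  | succ m ih =>
    intro R hR
    have hk : (B m).coeff m ≠ 0 := by
      have := hlead m
      rw [leadingCoeff, hdeg] at this
      exact this.ne'
    set t := R.coeff m / (B m).coeff m with ht
    have hd : (R - C t * B m).degree < m := by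
      rw [degree_lt_iff_coeff_zero]
      intro k hkm
      rcases hkm.eq_or_lt with rfl | hlt
      · simp [ht, hk]
      · have h1 := (degree_lt_iff_coeff_zero R (m + 1)).1 hR k hlt
        have h2 : (B m).coeff k = 0 := coeff_eq_zero_of_natDegree_lt (by rw [hdeg]; exact hlt)
        simp [h1, h2]
    have h0 := ih (by omega) _ hd
    have h1 := horth m n
    rw [if_neg (by omega)] at h1
    have e : ∀ v, R.eval v * (B n).eval v * w v =
        (R - C t * B m).eval v * (B n).eval v * w v +
          t * ((B m).eval v * (B n).eval v * w v) := by
      intro v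
      simp only [eval_sub, eval_mul, eval_C]
      ring
    simp_rw [e]
    rw [integral_add (hint _ _) ((hint _ _).const_mul t), integral_const_mul, h0, h1]
    simp


/-- For every n, c_{n+1}·∫₀^∞ B_{n+1}'(v)·B_n(v)·w(v) dv = n + 1. -/
theorem halfspace_hermite_deriv_cross_moment
    (u T : ℝ) (hT : 0 < T)
    (w : ℝ → ℝ) (hw : ∀ v, w v = Real.exp (-(v - u) ^ 2 / (2 * T)))
    (B : ℕ → Polynomial ℝ)
    (hdeg : ∀ n, (B n).natDegree = n)
    (hlead : ∀ n, 0 < (B n).leadingCoeff)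
    (horth : ∀ m n, ∫ v in Set.Ioi (0 : ℝ), (B m).eval v * (B n).eval v * w v
        = if m = n then 1 else 0)
    (α : ℕ → ℝ)
    (hα : ∀ n, α n = ∫ v in Set.Ioi (0 : ℝ), v * (B n).eval v ^ 2 * w v)
    (c : ℕ → ℝ) (hc0 : c 0 = 0)
    (hc : ∀ n, c (n + 1) = ∫ v in Set.Ioi (0 : ℝ), v * (B n).eval v * (B (n + 1)).eval v * w v)
    (β : ℕ → ℝ) (hβ : ∀ n, β n = c n ^ 2)
    (hrec : ∀ n, ∀ v : ℝ, c (n + 1) * (B (n + 1)).eval v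
        = (v - α n) * (B n).eval v - c n * (B (n - 1)).eval v)
    (hcpos : ∀ n, 1 ≤ n → 0 < c n) :
    ∀ n : ℕ, c (n + 1) * ∫ v in Set.Ioi (0 : ℝ),
      (Polynomial.derivative (B (n + 1))).eval v * (B n).eval v * w v = n + 1 := by
  intro n
  have hint : ∀ P Q : ℝ[X], IntegrableOn (fun v => P.eval v * Q.eval v * w v) (Set.Ioi 0) := by
    intro P Q
    have := (aux_integrable u T hT w hw (P * Q)).integrableOn (s := Set.Ioi 0)
    simpa only [eval_mul] using this
  have hp : C (c (n + 1)) * B (n + 1) = (X - C (α n)) * B n - C (c n) * B (n - 1) := by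
    apply Polynomial.funext
    intro v
    simpa using hrec n v
  have hz : ∀ m k, m < k → (B m).coeff k = 0 := fun m k h =>
    coeff_eq_zero_of_natDegree_lt (by rw [hdeg]; exact h)
  have hco : c (n + 1) * (B (n + 1)).coeff (n + 1) = (B n).coeff n := by
    have := congrArg (fun p => p.coeff (n + 1)) hp
    simpa [sub_mul, hz n (n + 1) (by omega), hz (n - 1) (n + 1) (by omega)] using this
  have hd : (C (c (n + 1)) * derivative (B (n + 1)) - C ((n : ℝ) + 1) * B n).degree < n := by
    rw [degree_lt_iff_coeff_zero]
    intro k hk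
    rcases hk.eq_or_lt with rfl | hlt
    · rw [coeff_sub, coeff_C_mul, coeff_C_mul, coeff_derivative, ← hco]
      ring
    · rw [coeff_sub, coeff_C_mul, coeff_C_mul, coeff_derivative, hz _ _ hlt,
        hz (n + 1) (k + 1) (by omega)]
      ring
  have h0 := aux_orth u T hT w hw B hdeg hlead horth n n le_rfl _ hd
  have h1 := horth n n
  rw [if_pos rfl] at h1
  have e : ∀ v, (C (c (n + 1)) * derivative (B (n + 1)) - C ((n : ℝ) + 1) * B n).eval v *
      (B n).eval v * w v = c (n + 1) * ((derivative (B (n + 1))).eval v * (B n).eval v * w v) -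
        ((n : ℝ) + 1) * ((B n).eval v * (B n).eval v * w v) := by
    intro v
    simp only [eval_sub, eval_mul, eval_C]
    ring
  simp_rw [e] at h0
  rw [integral_sub ((hint _ _).const_mul _) ((hint _ _).const_mul _), integral_const_mul,
    integral_const_mul, h1] at h0
  linarith
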